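/- Let F, C₁, …, C_m be real random variables on a common probability space (not necessarily independent), with F distributed as N(μ_f, σ_f²) and each C_j distributed as N(μ_j, σ_j²), where σ_f > 0 and σ_j > 0. Let y⁺ ∈ ℝ, κ₁, …, κ_m ∈ ℝ, and α > 0. Then the expected merit improvement has the closed form E[max(y⁺ − F, 0) + α·∑_{j=1}^m (κ_j − max(−C_j, 0))] = z_f·σ_f·Φ(z_f) + σ_f·φ(z_f) + α·∑_{j=1}^m κ_j + α·∑_{j=1}^m (μ_j·Φ(z_j) − σ_j·φ(z_j)), where z_f = (y⁺ − μ_f)/σ_f and z_j = −μ_j/σ_j. -/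

import Mathlib

open MeasureTheory ProbabilityTheory Real

/-- The standard normal probability density function φ(s) = (2π)^{-1/2} exp(−s²/2). -/
noncomputable def stdNormalPDF (s : ℝ) : ℝ :=
  (Real.sqrt (2 * Real.pi))⁻¹ * Real.exp (-(s ^ 2) / 2)

/-- The standard normal cumulative distribution function Φ(t) = ∫_{−∞}^{t} φ(s) ds. -/
noncomputable def stdNormalCDF (t : ℝ) : ℝ :=
  ∫ s in Set.Iic t, stdNormalPDF s

lemma stdNormalPDF_eq_gaussianPDFReal : stdNormalPDF = gaussianPDFReal 0 1 := by
  ext s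
  simp [stdNormalPDF, gaussianPDFReal]

lemma integrable_stdNormalPDF : Integrable stdNormalPDF := by
  rw [stdNormalPDF_eq_gaussianPDFReal]
  exact integrable_gaussianPDFReal 0 1

lemma integrable_neg_mul_stdNormalPDF : Integrable fun s => -s * stdNormalPDF s := by
  have h := (integrable_mul_exp_neg_mul_sq (b := 1 / 2) (by norm_num)).const_mul
    (-(Real.sqrt (2 * Real.pi))⁻¹)
  refine h.congr (.of_forall fun s => ?_)
  have hs : -(1 / 2) * s ^ 2 = -(s ^ 2) / 2 := by ring
  simp only [stdNormalPDF, hs]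
  ring

lemma hasDerivAt_stdNormalPDF (s : ℝ) :
    HasDerivAt stdNormalPDF (-s * stdNormalPDF s) s := by
  have h := ((((hasDerivAt_id s).pow 2).neg.div_const 2).exp).const_mul
    (Real.sqrt (2 * Real.pi))⁻¹
  refine h.congr_deriv ?_
  simp [stdNormalPDF]
  ring

lemma tendsto_stdNormalPDF_atBot : Filter.Tendsto stdNormalPDF Filter.atBot (nhds 0) :=
  tendsto_zero_of_hasDerivAt_of_integrableOn_Iic (a := 0)
    (fun s _ => hasDerivAt_stdNormalPDF s)
    integrable_neg_mul_stdNormalPDF.integrableOn integrable_stdNormalPDF.integrableOn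

lemma integral_max_sub_stdGaussian (z : ℝ) :
    ∫ x, max (z - x) 0 ∂(gaussianReal 0 1) = z * stdNormalCDF z + stdNormalPDF z := by
  rw [integral_gaussianReal_eq_integral_smul one_ne_zero, ← stdNormalPDF_eq_gaussianPDFReal]
  have hind : (fun x => stdNormalPDF x • max (z - x) 0) =
      (Set.Iic z).indicator fun x => z * stdNormalPDF x + -x * stdNormalPDF x := by
    ext x
    by_cases hx : x ≤ z
    · rw [Set.indicator_of_mem (Set.mem_Iic.2 hx), max_eq_left (sub_nonneg.2 hx), smul_eq_mul]
      ring
    · rw [Set.indicator_of_notMem (by simpa using hx), max_eq_right (by linarith), smul_zero]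
  rw [hind, integral_indicator measurableSet_Iic,
    integral_add (integrable_stdNormalPDF.const_mul z).integrableOn
      integrable_neg_mul_stdNormalPDF.integrableOn, integral_const_mul,
    integral_Iic_of_hasDerivAt_of_tendsto' (fun s _ => hasDerivAt_stdNormalPDF s)
      integrable_neg_mul_stdNormalPDF.integrableOn tendsto_stdNormalPDF_atBot, sub_zero,
    stdNormalCDF]

lemma integral_max_sub_gaussianReal (y μ : ℝ) {σ : ℝ} (hσ : 0 < σ) :
    ∫ x, max (y - x) 0 ∂(gaussianReal μ ⟨σ ^ 2, sq_nonneg σ⟩) =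
      (y - μ) / σ * σ * stdNormalCDF ((y - μ) / σ) + σ * stdNormalPDF ((y - μ) / σ) := by
  have hmap : gaussianReal μ ⟨σ ^ 2, sq_nonneg σ⟩ =
      ((gaussianReal 0 1).map (σ * ·)).map (· + μ) := by
    rw [gaussianReal_map_const_mul, gaussianReal_map_add_const, mul_zero, zero_add, mul_one]
    rfl
  rw [hmap, integral_map (by fun_prop) (by fun_prop), integral_map (by fun_prop) (by fun_prop)]
  have hscale (x : ℝ) : max (y - (σ * x + μ)) 0 = σ * max ((y - μ) / σ - x) 0 := by
    rw [mul_max_of_nonneg _ _ hσ.le, mul_zero, mul_sub, mul_div_cancel₀ _ hσ.ne']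
    ring_nf
  simp only [hscale]
  rw [integral_const_mul, integral_max_sub_stdGaussian]
  ring

section LawOfGaussian

variable {Ω : Type*} [MeasurableSpace Ω] {P : Measure Ω} {X : Ω → ℝ} {μ : ℝ}

lemma integrable_max_sub_of_map_eq_gaussianReal {v : NNReal} [IsFiniteMeasure P]
    (hX : Measurable X) (hlaw : P.map X = gaussianReal μ v) (y : ℝ) :
    Integrable (fun ω => max (y - X ω) 0) P := by
  have hid : Integrable id (P.map X) := by
    rw [hlaw]
    exact memLp_one_iff_integrable.1 (memLp_id_gaussianReal 1)
  have hint : Integrable X P := hid.comp_measurable hX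
  exact ((integrable_const y).sub hint).pos_part

lemma integral_max_sub_of_map_eq_gaussianReal {σ : ℝ} (hσ : 0 < σ) (hX : Measurable X)
    (hlaw : P.map X = gaussianReal μ ⟨σ ^ 2, sq_nonneg σ⟩) (y : ℝ) :
    ∫ ω, max (y - X ω) 0 ∂P =
      (y - μ) / σ * σ * stdNormalCDF ((y - μ) / σ) + σ * stdNormalPDF ((y - μ) / σ) := by
  rw [← integral_max_sub_gaussianReal y μ hσ, ← hlaw,
    integral_map hX.aemeasurable (by fun_prop)]

end LawOfGaussian

/-- Expected merit improvement: if F ~ N(μ_f, σ_f²) and C_j ~ N(μ_j, σ_j²) (no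
independence needed), σ_f, σ_j > 0, y⁺, κ_j ∈ ℝ, α > 0, then, with z_f = (y⁺ − μ_f)/σ_f
and z_j = −μ_j/σ_j,
E[max(y⁺ − F, 0) + α·∑_j (κ_j − max(−C_j, 0))]
  = z_f·σ_f·Φ(z_f) + σ_f·φ(z_f) + α·∑_j κ_j + α·∑_j (μ_j·Φ(z_j) − σ_j·φ(z_j)). -/
theorem expected_merit_improvement_gaussian {Ω : Type*} [MeasurableSpace Ω]
    (P : Measure Ω) [IsProbabilityMeasure P] (m : ℕ)
    (F : Ω → ℝ) (C : Fin m → Ω → ℝ) (hF : Measurable F) (hC : ∀ j, Measurable (C j))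
    (μf σf : ℝ) (μ σ : Fin m → ℝ) (hσf : 0 < σf) (hσ : ∀ j, 0 < σ j)
    (hFdist : P.map F = gaussianReal μf ⟨σf ^ 2, sq_nonneg σf⟩)
    (hCdist : ∀ j, P.map (C j) = gaussianReal (μ j) ⟨(σ j) ^ 2, sq_nonneg (σ j)⟩)
    (yplus : ℝ) (κ : Fin m → ℝ) (α : ℝ) (hα : 0 < α) :
    (∫ ω, (max (yplus - F ω) 0 + α * ∑ j, (κ j - max (-(C j ω)) 0)) ∂P)
      = ((yplus - μf) / σf) * σf * stdNormalCDF ((yplus - μf) / σf)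
          + σf * stdNormalPDF ((yplus - μf) / σf)
          + α * ∑ j, κ j
          + α * ∑ j, (μ j * stdNormalCDF (-(μ j) / σ j)
              - σ j * stdNormalPDF (-(μ j) / σ j)) := by
  have hCint (j : Fin m) : Integrable (fun ω => max (-(C j ω)) 0) P := by
    simpa using integrable_max_sub_of_map_eq_gaussianReal (hC j) (hCdist j) 0
  have hCval (j : Fin m) : ∫ ω, max (-(C j ω)) 0 ∂P =
      -(μ j * stdNormalCDF (-(μ j) / σ j) - σ j * stdNormalPDF (-(μ j) / σ j)) := by
    have h := integral_max_sub_of_map_eq_gaussianReal (hσ j) (hC j) (hCdist j) 0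
    simp only [zero_sub, div_mul_cancel₀ _ (hσ j).ne'] at h
    rw [h]
    ring
  have hterm (j : Fin m) : Integrable (fun ω => κ j - max (-(C j ω)) 0) P :=
    (integrable_const _).sub (hCint j)
  rw [integral_add (integrable_max_sub_of_map_eq_gaussianReal hF hFdist yplus)
      ((integrable_finsetSum _ fun j _ => hterm j).const_mul α),
    integral_max_sub_of_map_eq_gaussianReal hσf hF hFdist, integral_const_mul,
    integral_finsetSum _ fun j _ => hterm j, add_assoc (_ + _), ← mul_add,
    ← Finset.sum_add_distrib]
  congr 2
  refine Finset.sum_congr rfl fun j _ => ?_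
  rw [integral_sub (integrable_const _) (hCint j), hCval]
  simp only [integral_const, probReal_univ, one_smul]
  ring
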